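/- arXiv:1707.07130 — 2 statements merged into one kernel-verified Lean document; each statement's English description precedes it below -/
import Mathlib

section
/- Let k be a non-negative integer and let τ be a locally compact Hausdorff shift-continuous topology on B⁰(B_k) in which the adjoined zero 0* is not isolated. Then for every open neighborhood U of 0* and every non-negative integer n there exists a positive integer t_n such that [n,m] ⊆ U for every integer m > t_n. -/
open Ordinal Set Topology

noncomputable section

/-- The `α`-bicyclic monoid: pairs of ordinals below `ω ^ α`. -/
def Bicyclic (α : Ordinal) : Type 1 :=
  {p : Ordinal × Ordinal // p.1 < ω ^ α ∧ p.2 < ω ^ α}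

namespace Bicyclic

variable {α : Ordinal}

def mk (a b : Ordinal) (ha : a < ω ^ α) (hb : b < ω ^ α) : Bicyclic α :=
  ⟨(a, b), ha, hb⟩

instance : Mul (Bicyclic α) :=
  ⟨fun x y =>
    if x.val.2 ≤ y.val.1 then
      ⟨(x.val.1 + (y.val.1 - x.val.2), y.val.2),
        (principal_add_omega0_opow α) x.2.1
          (lt_of_le_of_lt (Ordinal.sub_le_self _ _) y.2.1),
        y.2.2⟩
    else
      ⟨(x.val.1, y.val.2 + (x.val.2 - y.val.1)),
        x.2.1,
        (principal_add_omega0_opow α) y.2.2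
          (lt_of_le_of_lt (Ordinal.sub_le_self _ _) x.2.2)⟩⟩

instance : One (Bicyclic α) :=
  ⟨⟨(0, 0), opow_pos α omega0_pos, opow_pos α omega0_pos⟩⟩

end Bicyclic

/-- The Bruck extension of a semigroup `S`. -/
def Bruck (S : Type*) : Type _ := ℕ × S × ℕ

def Bruck.mk {S : Type*} (n : ℕ) (s : S) (m : ℕ) : Bruck S := (n, s, m)

instance {S : Type*} [Mul S] : Mul (Bruck S) :=
  ⟨fun x y =>
    if x.2.2 < y.1 then (x.1 + y.1 - x.2.2, y.2.1, y.2.2)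
    else if y.1 < x.2.2 then (x.1, x.2.1, y.2.2 + x.2.2 - y.1)
    else (x.1, x.2.1 * y.2.1, y.2.2)⟩

/-- The Bruck extension of `S` with an adjoined (absorbing) zero `0*`. -/
abbrev BruckZero (S : Type*) := WithZero (Bruck S)

/-- The box `[n,m]` in the Bruck extension with zero. -/
def box (S : Type*) (n m : ℕ) : Set (BruckZero S) :=
  {x | ∃ s : S, x = ↑(Bruck.mk n s m)}

/-- A topology on `X` is shift-continuous if all two-sided shifts `x ↦ a * x * b`
are continuous. -/
def ShiftContinuous (X : Type*) [Mul X] [TopologicalSpace X] : Prop :=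
  ∀ a b : X, Continuous fun x => a * x * b

namespace Bicyclic

variable {α : Ordinal}

protected theorem one_mul (x : Bicyclic α) : 1 * x = x := by
  have h : (0 : Ordinal) ≤ x.val.1 := zero_le
  refine (if_pos h).trans (Subtype.ext (Prod.ext ?_ rfl))
  change (0 : Ordinal) + (x.val.1 - 0) = x.val.1
  simp

protected theorem mul_one (x : Bicyclic α) : x * 1 = x := by
  by_cases h : x.val.2 ≤ (0 : Ordinal)
  · have hx : x.val.2 = 0 := le_antisymm h zero_le
    refine (if_pos h).trans (Subtype.ext (Prod.ext ?_ hx.symm))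
    change x.val.1 + ((0 : Ordinal) - x.val.2) = x.val.1
    simp
  · refine (if_neg h).trans (Subtype.ext (Prod.ext rfl ?_))
    change (0 : Ordinal) + (x.val.2 - 0) = x.val.2
    simp

end Bicyclic

namespace BruckZero

variable {S : Type*}

/-- The nonzero element `(n, s, m)` of the Bruck extension with zero. -/
def pt (n : ℕ) (s : S) (m : ℕ) : BruckZero S := ↑(Bruck.mk n s m)

theorem pt_ne_zero (n : ℕ) (s : S) (m : ℕ) : pt n s m ≠ 0 := WithZero.coe_ne_zero

theorem pt_inj {n n' m m' : ℕ} {s s' : S} :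
    pt n s m = pt n' s' m' ↔ n = n' ∧ s = s' ∧ m = m' := by
  refine WithZero.coe_inj.trans ?_
  exact Prod.mk_inj.trans (and_congr_right fun _ => Prod.mk_inj)

theorem eq_zero_or_pt (x : BruckZero S) : x = 0 ∨ ∃ n s m, x = pt n s m := by
  induction x using WithZero.recZeroCoe with
  | zero => exact Or.inl rfl
  | coe x => exact Or.inr ⟨x.1, x.2.1, x.2.2, rfl⟩

/-- The union of the boxes `[n,m]` with `n, m < N`. -/
def corner (S : Type*) (N : ℕ) : Set (BruckZero S) :=
  {x | ∃ n s m, x = pt n s m ∧ n < N ∧ m < N}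

theorem pt_mem_corner {n m N : ℕ} {s : S} : pt n s m ∈ corner S N ↔ n < N ∧ m < N := by
  constructor
  · rintro ⟨n', s', m', h, hn, hm⟩
    obtain ⟨rfl, rfl, rfl⟩ := pt_inj.1 h
    exact ⟨hn, hm⟩
  · exact fun h => ⟨n, s, m, rfl, h⟩

theorem zero_notMem_corner (N : ℕ) : (0 : BruckZero S) ∉ corner S N := by
  rintro ⟨n, s, m, h, -⟩
  exact pt_ne_zero n s m h.symm

theorem corner_mono : Monotone (corner S) := by
  rintro M N h x ⟨n, s, m, rfl, hn, hm⟩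
  exact pt_mem_corner.2 ⟨hn.trans_le h, hm.trans_le h⟩

section Mul

variable [Mul S]

theorem pt_mul_pt (a b c d : ℕ) (s t : S) :
    pt a s b * pt c t d =
      if b < c then pt (a + c - b) t d
      else if c < b then pt a s (d + b - c)
      else pt a (s * t) d := by
  change ((Bruck.mk a s b * Bruck.mk c t d : Bruck S) : BruckZero S) = _
  have h : Bruck.mk a s b * Bruck.mk c t d =
      if b < c then Bruck.mk (a + c - b) t d
      else if c < b then Bruck.mk a s (d + b - c)
      else Bruck.mk a (s * t) d := rfl
  rw [h]
  split_ifs <;> rfl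

variable {e : S}

theorem mul_unit (hr : ∀ s, s * e = s) (x : BruckZero S) : x * pt 0 e 0 = x := by
  obtain rfl | ⟨n, s, m, rfl⟩ := eq_zero_or_pt x
  · exact zero_mul _
  · rw [pt_mul_pt]
    split_ifs with h h'
    · omega
    · simp
    · rw [hr, show m = 0 by omega]

theorem unit_mul (hl : ∀ s, e * s = s) (x : BruckZero S) : pt 0 e 0 * x = x := by
  obtain rfl | ⟨n, s, m, rfl⟩ := eq_zero_or_pt x
  · exact mul_zero _
  · rw [pt_mul_pt]
    split_ifs with h h'
    · simp
    · omega
    · rw [hl, show n = 0 by omega]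

variable [TopologicalSpace (BruckZero S)]

theorem continuous_mul_left (hr : ∀ s, s * e = s)
    (hτ : ShiftContinuous (BruckZero S))
    (a : BruckZero S) : Continuous fun x => a * x := by
  simpa only [mul_unit hr] using hτ a (pt 0 e 0)

theorem continuous_mul_right (hl : ∀ s, e * s = s) (hτ : ShiftContinuous (BruckZero S))
    (b : BruckZero S) : Continuous fun x => x * b := by
  simpa only [unit_mul hl] using hτ (pt 0 e 0) b

theorem isOpen_corner (hl : ∀ s, e * s = s) (hr : ∀ s, s * e = s)
    (hτ : ShiftContinuous (BruckZero S))
    [T2Space (BruckZero S)] (N : ℕ) : IsOpen (corner S N) := by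
  have h : corner S N =
      {x | pt N e N * x = x}ᶜ ∩ {x | x * pt N e N = x}ᶜ := by
    ext x
    obtain rfl | ⟨n, s, m, rfl⟩ := eq_zero_or_pt x
    · simp [zero_notMem_corner]
    · rw [pt_mem_corner]
      refine and_congr ?_ ?_
      · rw [mem_compl_iff, mem_ofPred_eq, pt_mul_pt]
        split_ifs with h h' <;> simp only [pt_inj, hl] <;> grind
      · rw [mem_compl_iff, mem_ofPred_eq, pt_mul_pt]
        split_ifs with h h' <;> simp only [pt_inj, hr] <;> grind
  rw [h]
  exact (isClosed_eq (continuous_mul_left hr hτ _) continuous_id).isOpen_compl.inter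
    (isClosed_eq (continuous_mul_right hl hτ _) continuous_id).isOpen_compl

/-- A compact set missing the zero meets only finitely many boxes. -/
theorem exists_subset_corner (hl : ∀ s, e * s = s) (hr : ∀ s, s * e = s)
    (hτ : ShiftContinuous (BruckZero S))
    [T2Space (BruckZero S)] {C : Set (BruckZero S)}
    (hC : IsCompact C) (h0 : 0 ∉ C) : ∃ N, C ⊆ corner S N := by
  refine hC.elim_directed_cover (corner S) (isOpen_corner hl hr hτ) ?_
    corner_mono.directed_le
  intro x hx
  obtain rfl | ⟨n, s, m, rfl⟩ := eq_zero_or_pt x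
  · exact absurd hx h0
  · exact mem_iUnion.2 ⟨n + m + 1, pt_mem_corner.2 ⟨by omega, by omega⟩⟩

/-- A continuous map fixing the zero maps a compact neighborhood of zero into itself, up to
finitely many boxes. -/
theorem exists_forall_map_mem (hl : ∀ s, e * s = s) (hr : ∀ s, s * e = s)
    (hτ : ShiftContinuous (BruckZero S))
    [T2Space (BruckZero S)] {K : Set (BruckZero S)}
    (hK : IsCompact K) (hK0 : K ∈ 𝓝 0) {f : BruckZero S → BruckZero S} (hf : Continuous f)
    (hf0 : f 0 = 0) : ∃ N, ∀ x ∈ K, x ∉ corner S N → f x ∈ K := by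
  obtain ⟨N, hN⟩ := exists_subset_corner hl hr hτ
    (hK.diff (isOpen_interior.preimage hf) : IsCompact (K \ f ⁻¹' interior K))
    (fun h => h.2 (by rw [mem_preimage, hf0]; exact mem_interior_iff_mem_nhds.2 hK0))
  refine ⟨N, fun x hx hxN => ?_⟩
  by_contra h
  exact hxN (hN ⟨hx, fun h' => h (interior_subset h')⟩)

/-- If zero is not isolated, its neighborhoods meet infinitely many boxes. -/
theorem exists_pt_mem_of_mem_nhds (hr : ∀ s, s * e = s)
    (hτ : ShiftContinuous (BruckZero S))
    (h0 : ¬ IsOpen ({0} : Set (BruckZero S)))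
    {K : Set (BruckZero S)} (hK0 : K ∈ 𝓝 0) (N : ℕ) :
    ∃ n s m, N ≤ n ∧ pt n s m ∈ K := by
  by_contra! H
  apply h0
  have hV : (fun x => pt N e 0 * x) ⁻¹' interior K = {0} := by
    ext x
    rw [mem_preimage, mem_singleton_iff]
    obtain rfl | ⟨n, s, m, rfl⟩ := eq_zero_or_pt x
    · simpa using mem_interior_iff_mem_nhds.2 hK0
    · refine iff_of_false (fun h => ?_) (pt_ne_zero _ _ _)
      have h' := interior_subset h
      rw [pt_mul_pt] at h'
      split_ifs at h' with h₁ h₂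
      · exact H _ _ _ (by omega) h'
      · omega
      · exact H _ _ _ le_rfl h'
  rw [← hV]
  exact isOpen_interior.preimage (continuous_mul_left hr hτ _)

/-- A compact neighborhood of a non-isolated zero contains all but finitely many boxes. -/
theorem exists_compl_corner_subset (hl : ∀ s, e * s = s) (hr : ∀ s, s * e = s)
    (hτ : ShiftContinuous (BruckZero S))
    [T2Space (BruckZero S)]
    (h0 : ¬ IsOpen ({0} : Set (BruckZero S))) {K : Set (BruckZero S)}
    (hK : IsCompact K) (hK0 : K ∈ 𝓝 0) : ∃ N, (corner S N)ᶜ ⊆ K := by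
  have hleft : ∀ a, ∃ N, ∀ x ∈ K, x ∉ corner S N → a * x ∈ K := fun a =>
    exists_forall_map_mem hl hr hτ hK hK0 (continuous_mul_left hr hτ a) (mul_zero a)
  have hright : ∀ a, ∃ N, ∀ x ∈ K, x ∉ corner S N → x * a ∈ K := fun a =>
    exists_forall_map_mem hl hr hτ hK hK0 (continuous_mul_right hl hτ a) (zero_mul a)
  obtain ⟨N₁, h₁⟩ := hleft (pt 0 e 1)
  obtain ⟨N₂, h₂⟩ := hleft (pt 1 e 0)
  obtain ⟨N₃, h₃⟩ := hright (pt 0 e 1)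
  obtain ⟨N₄, h₄⟩ := hright (pt 1 e 0)
  obtain ⟨N, hN₁, hN₂, hN₃, hN₄⟩ : ∃ N, N₁ ≤ N ∧ N₂ ≤ N ∧ N₃ ≤ N ∧ N₄ ≤ N :=
    ⟨N₁ + N₂ + N₃ + N₄, by omega, by omega, by omega, by omega⟩
  have up : ∀ n s m, N ≤ n ∨ N ≤ m → pt n s m ∈ K → pt (n + 1) s m ∈ K := by
    intro n s m h hx
    have := h₂ _ hx (by rw [pt_mem_corner]; omega)
    rw [pt_mul_pt] at this
    split_ifs at this with h' h''
    · rwa [show 1 + n - 0 = n + 1 by omega] at this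
    · omega
    · rwa [hl, show 1 = n + 1 by omega] at this
  have down : ∀ n s m, N ≤ n + 1 ∨ N ≤ m → pt (n + 1) s m ∈ K → pt n s m ∈ K := by
    intro n s m h hx
    have := h₁ _ hx (by rw [pt_mem_corner]; omega)
    rw [pt_mul_pt] at this
    split_ifs at this with h' h''
    · rwa [show 0 + (n + 1) - 1 = n by omega] at this
    · omega
    · rwa [hl, show 0 = n by omega] at this
  have right : ∀ n s m, N ≤ n ∨ N ≤ m → pt n s m ∈ K → pt n s (m + 1) ∈ K := by
    intro n s m h hx
    have := h₃ _ hx (by rw [pt_mem_corner]; omega)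
    rw [pt_mul_pt] at this
    split_ifs at this with h' h''
    · omega
    · rwa [show 1 + m - 0 = m + 1 by omega] at this
    · rwa [hr, show 1 = m + 1 by omega] at this
  have left : ∀ n s m, N ≤ n ∨ N ≤ m + 1 → pt n s (m + 1) ∈ K → pt n s m ∈ K := by
    intro n s m h hx
    have := h₄ _ hx (by rw [pt_mem_corner]; omega)
    rw [pt_mul_pt] at this
    split_ifs at this with h' h''
    · omega
    · rwa [show 0 + (m + 1) - 1 = m by omega] at this
    · rwa [hr, show 0 = m by omega] at this
  have up_iff : ∀ s n m, N ≤ m → (pt n s m ∈ K ↔ pt 0 s m ∈ K) := by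
    intro s n m h
    induction n with
    | zero => rfl
    | succ n ih => exact ⟨fun hx => ih.1 (down n s m (Or.inr h) hx),
        fun hx => up n s m (Or.inr h) (ih.2 hx)⟩
  have right_iff : ∀ s n m, N ≤ n → (pt n s m ∈ K ↔ pt n s 0 ∈ K) := by
    intro s n m h
    induction m with
    | zero => rfl
    | succ m ih => exact ⟨fun hx => ih.1 (left n s m (Or.inl h) hx),
        fun hx => right n s m (Or.inl h) (ih.2 hx)⟩
  have to_base : ∀ s n m, N ≤ n ∨ N ≤ m → (pt n s m ∈ K ↔ pt N s N ∈ K) := by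
    have hcol : ∀ s m, N ≤ m → (pt 0 s m ∈ K ↔ pt N s N ∈ K) := fun s m h => by
      rw [← up_iff s N m h, right_iff s N m le_rfl, right_iff s N N le_rfl]
    rintro s n m (h | h)
    · rw [right_iff s n m h, ← right_iff s n N h, up_iff s n N le_rfl, hcol s N le_rfl]
    · rw [up_iff s n m h, hcol s m h]
  have he : pt N e N ∈ K := by
    obtain ⟨n, s, m, hn, hx⟩ := exists_pt_mem_of_mem_nhds hr hτ h0 hK0 N
    have hx' : pt 0 s N ∈ K :=
      (to_base s 0 N (Or.inr le_rfl)).2 ((to_base s n m (Or.inl hn)).1 hx)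
    have := h₁ _ hx' (by rw [pt_mem_corner]; omega)
    rw [pt_mul_pt, if_neg (by omega), if_pos (by omega)] at this
    exact (to_base e 0 _ (Or.inr (by omega))).1 this
  refine ⟨N, fun x hx => ?_⟩
  obtain rfl | ⟨n, s, m, rfl⟩ := eq_zero_or_pt x
  · exact mem_of_mem_nhds hK0
  rw [mem_compl_iff, pt_mem_corner] at hx
  obtain ⟨M, hM⟩ := hleft (pt 0 s 0)
  have := hM _ ((to_base e 0 (N + M) (Or.inr (by omega))).2 he)
    (by rw [pt_mem_corner]; omega)
  rw [pt_mul_pt, if_neg (lt_irrefl _), if_neg (lt_irrefl _), hr] at this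
  exact (to_base s n m (by omega)).2 ((to_base s 0 _ (Or.inr (by omega))).1 this)

end Mul

end BruckZero

/-- For a locally compact Hausdorff shift-continuous topology on
`B⁰(B_k)` with non-isolated zero, for every open neighborhood `U` of `0*` and every
`n ∈ ω` there is a positive integer `t_n` with `[n,m] ⊆ U` for all `m > t_n`. -/
theorem boxes_eventually_contained (k : ℕ)
    [TopologicalSpace (BruckZero (Bicyclic k))] [T2Space (BruckZero (Bicyclic k))]
    [LocallyCompactSpace (BruckZero (Bicyclic k))]
    (hτ : ShiftContinuous (BruckZero (Bicyclic k)))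
    (h0 : ¬ IsOpen ({0} : Set (BruckZero (Bicyclic k))))
    (U : Set (BruckZero (Bicyclic k)))
    (hU : IsOpen U) (h0U : (0 : BruckZero (Bicyclic k)) ∈ U) (n : ℕ) :
    ∃ tn : ℕ, 0 < tn ∧ ∀ m : ℕ, tn < m → box (Bicyclic k) n m ⊆ U := by
  obtain ⟨K, hK0, hKU, hK⟩ := local_compact_nhds (hU.mem_nhds h0U)
  obtain ⟨N, hN⟩ := BruckZero.exists_compl_corner_subset Bicyclic.one_mul Bicyclic.mul_one
    hτ h0 hK hK0
  refine ⟨N + 1, N.succ_pos, ?_⟩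
  rintro m hm _ ⟨s, rfl⟩
  refine hKU (hN fun h => ?_)
  have := (BruckZero.pt_mem_corner.1 h).2
  omega
end
end

section
/- Let k be a non-negative integer and let τ be a locally compact Hausdorff shift-continuous topology on the monoid B⁰(B_k). If the adjoined zero 0* is not isolated in τ, then the space (B⁰(B_k), τ) is compact. -/
open Ordinal Set Topology

noncomputable section

namespace Bicyclic

variable {α : Ordinal}

theorem mul_def (x y : Bicyclic α) : (x * y).val =
    if x.val.2 ≤ y.val.1 then (x.val.1 + (y.val.1 - x.val.2), y.val.2)
    else (x.val.1, y.val.2 + (x.val.2 - y.val.1)) := by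
  by_cases h : x.val.2 ≤ y.val.1
  · rw [if_pos h]
    exact congrArg Subtype.val (if_pos h)
  · rw [if_neg h]
    exact congrArg Subtype.val (if_neg h)

theorem one_def : (1 : Bicyclic α).val = (0, 0) := rfl

instance : MulOneClass (Bicyclic α) where
  one_mul x := Subtype.ext <| by simp [mul_def, one_def]
  mul_one x := Subtype.ext <| by
    rw [mul_def, one_def]
    split_ifs with h
    · have h2 : x.val.2 = 0 := by simpa using h
      ext <;> simp [h2]
    · simp

end Bicyclic

/-- A subset of `ℕ × ℕ` closed under unit steps away from a square contains the complement of the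
square as soon as it contains one point of the complement. -/
theorem Nat.forall_of_unit_steps_of_lt {A : ℕ → ℕ → Prop} {N : ℕ}
    (hr : ∀ n m, (N < n ∨ N < m) → A n m → A n (m + 1))
    (hl : ∀ n m, (N < n ∨ N < m + 1) → A n (m + 1) → A n m)
    (hu : ∀ n m, (N < n ∨ N < m) → A n m → A (n + 1) m)
    (hd : ∀ n m, (N < n + 1 ∨ N < m) → A (n + 1) m → A n m)
    {n m : ℕ} (hnm : N < n ∨ N < m) (h : A n m) {n' m' : ℕ} (hnm' : N < n' ∨ N < m') :
    A n' m' := by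
  have row : ∀ n, N < n → ∀ m, A n m ↔ A n 0 := by
    intro n hn m
    induction m with
    | zero => rfl
    | succ m ih => rw [← ih]; exact ⟨hl n m (.inl hn), hr n m (.inl hn)⟩
  have col : ∀ m, N < m → ∀ n, A n m ↔ A 0 m := by
    intro m hm n
    induction n with
    | zero => rfl
    | succ n ih => rw [← ih]; exact ⟨hd n m (.inr hm), hu n m (.inr hm)⟩
  have corner : A (N + 1) (N + 1) := by
    rcases hnm with hn | hm
    · rw [col _ (by omega), ← col _ (by omega) n, row _ hn, ← row _ hn m]; exact h
    · rw [row _ (by omega), ← row _ (by omega) m, col _ hm, ← col _ hm n]; exact h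
  rcases hnm' with hn | hm
  · rw [row _ hn, ← row _ hn (N + 1), col _ (by omega), ← col _ (by omega) (N + 1)]; exact corner
  · rw [col _ hm, ← col _ hm (N + 1), row _ (by omega), ← row _ (by omega) (N + 1)]; exact corner

namespace BruckZero

/-- The nonzero element `(n, s, m)` of the Bruck extension with zero. -/
abbrev mk {S : Type*} (n : ℕ) (s : S) (m : ℕ) : BruckZero S := ↑(Bruck.mk n s m)

section Mul

variable {S : Type*} [Mul S]

theorem mul_of_lt {a b c d : ℕ} (s t : S) (h : b < c) :
    mk a s b * mk c t d = mk (a + c - b) t d := by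
  rw [← WithZero.coe_mul]
  exact congrArg _ (if_pos h)

theorem mul_of_gt {a b c d : ℕ} (s t : S) (h : c < b) :
    mk a s b * mk c t d = mk a s (d + b - c) := by
  rw [← WithZero.coe_mul]
  exact congrArg _ ((if_neg h.not_gt).trans (if_pos h))

theorem mul_of_eq (a b d : ℕ) (s t : S) :
    mk a s b * mk b t d = mk a (s * t) d := by
  rw [← WithZero.coe_mul]
  exact congrArg _ ((if_neg (lt_irrefl b)).trans (if_neg (lt_irrefl b)))

end Mul

theorem mk_inj {S : Type*} {a b c d : ℕ} {s t : S} :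
    mk a s b = mk c t d ↔ a = c ∧ s = t ∧ b = d := by
  rw [WithZero.coe_inj]
  change ((a, s, b) : ℕ × S × ℕ) = (c, t, d) ↔ _
  simp

theorem eq_zero_or_eq_mk {S : Type*} (x : BruckZero S) :
    x = 0 ∨ ∃ n s m, x = mk n s m := by
  cases x using WithZero.recZeroCoe with
  | zero => exact Or.inl rfl
  | coe x => exact Or.inr ⟨x.1, x.2.1, x.2.2, rfl⟩

section Shifts

variable {S : Type*} [MulOneClass S]

theorem mk_mul_of_le {b c : ℕ} (a : ℕ) (t : S) (d : ℕ) (h : b ≤ c) :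
    mk a 1 b * mk c t d = mk (a + c - b) t d := by
  rcases h.lt_or_eq with h | rfl
  · exact mul_of_lt _ _ h
  · rw [mul_of_eq, one_mul, Nat.add_sub_cancel]

theorem mul_mk_of_le {b c : ℕ} (a : ℕ) (s : S) (d : ℕ) (h : c ≤ b) :
    mk a s b * mk c 1 d = mk a s (d + b - c) := by
  rcases h.lt_or_eq with h | rfl
  · exact mul_of_gt _ _ h
  · rw [mul_of_eq, mul_one, Nat.add_sub_cancel]

theorem identity_mul (x : BruckZero S) : mk 0 1 0 * x = x := by
  rcases eq_zero_or_eq_mk x with rfl | ⟨n, s, m, rfl⟩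
  · exact mul_zero _
  · rw [mk_mul_of_le _ _ _ n.zero_le]; simp

theorem mul_identity (x : BruckZero S) : x * mk 0 1 0 = x := by
  rcases eq_zero_or_eq_mk x with rfl | ⟨n, s, m, rfl⟩
  · exact zero_mul _
  · rw [mul_mk_of_le _ _ _ m.zero_le]; simp

variable (S) in
/-- The boxes `[n,m]` with `n, m ≤ N`, described as the set of elements fixed neither by the left
nor by the right shift by the idempotent `(N+1, 1, N+1)`. -/
def lowerBoxes (N : ℕ) : Set (BruckZero S) :=
  {x | mk (N + 1) 1 (N + 1) * x ≠ x ∧ x * mk (N + 1) 1 (N + 1) ≠ x}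

theorem zero_notMem_lowerBoxes (N : ℕ) : (0 : BruckZero S) ∉ lowerBoxes S N :=
  fun h => h.1 (mul_zero _)

theorem mk_mem_lowerBoxes {N n m : ℕ} {s : S} :
    mk n s m ∈ lowerBoxes S N ↔ n ≤ N ∧ m ≤ N := by
  refine and_congr ?_ ?_
  · rcases le_or_gt n N with h | h
    · rw [mul_of_gt _ _ (by omega), ne_eq, mk_inj]; omega
    · rw [mk_mul_of_le _ _ _ (by omega), ne_eq, mk_inj]
      have : N + 1 + n - (N + 1) = n := by omega
      simp [this, h]
  · rcases le_or_gt m N with h | h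
    · rw [mul_of_lt _ _ (by omega), ne_eq, mk_inj]; omega
    · rw [mul_mk_of_le _ _ _ (by omega), ne_eq, mk_inj]
      have : N + 1 + m - (N + 1) = m := by omega
      simp [this, h]

theorem monotone_lowerBoxes : Monotone (lowerBoxes S) := by
  intro N M h x hx
  rcases eq_zero_or_eq_mk x with rfl | ⟨n, s, m, rfl⟩
  · exact absurd hx (zero_notMem_lowerBoxes N)
  · rw [mk_mem_lowerBoxes] at hx ⊢
    omega

theorem exists_mem_lowerBoxes {x : BruckZero S} (hx : x ≠ 0) : ∃ N, x ∈ lowerBoxes S N := by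
  rcases eq_zero_or_eq_mk x with rfl | ⟨n, s, m, rfl⟩
  · exact absurd rfl hx
  · exact ⟨max n m, mk_mem_lowerBoxes.2 ⟨le_max_left _ _, le_max_right _ _⟩⟩

/-- A two-sided shift that collapses the boxes `[n,m]`, `n, m ≤ N`, to a finite set missing `0`. -/
theorem shift_lowerBoxes_subset (N : ℕ) {x : BruckZero S} (hx : x ∈ lowerBoxes S N) :
    mk 0 1 (N + 1) * x * mk (N + 1) 1 0 ∈
      (fun p : ℕ × ℕ => mk p.1 (1 : S) p.2) '' (Iic (N + 1, N + 1)) := by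
  rcases eq_zero_or_eq_mk x with rfl | ⟨n, s, m, rfl⟩
  · exact absurd hx (zero_notMem_lowerBoxes N)
  · obtain ⟨hn, hm⟩ := mk_mem_lowerBoxes.1 hx
    rw [mul_of_gt _ _ (by omega)]
    rcases lt_or_ge (m + (N + 1) - n) (N + 1) with h | h
    · rw [mul_of_lt _ _ h]
      exact ⟨(_, _), ⟨by dsimp only; omega, by dsimp only; omega⟩, rfl⟩
    · rw [mul_mk_of_le _ _ _ h]
      exact ⟨(_, _), ⟨by dsimp only; omega, by dsimp only; omega⟩, rfl⟩

variable [TopologicalSpace (BruckZero S)]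

theorem continuous_const_mul (hτ : ShiftContinuous (BruckZero S)) (a : BruckZero S) :
    Continuous fun x => a * x := by
  simpa only [mul_identity] using hτ a (mk 0 1 0)

theorem continuous_mul_const (hτ : ShiftContinuous (BruckZero S)) (b : BruckZero S) :
    Continuous fun x => x * b := by
  simpa only [identity_mul] using hτ (mk 0 1 0) b

variable [T2Space (BruckZero S)]

theorem isOpen_lowerBoxes (hτ : ShiftContinuous (BruckZero S)) (N : ℕ) :
    IsOpen (lowerBoxes S N) :=
  (isOpen_ne_fun (continuous_const_mul hτ _) continuous_id).inter
    (isOpen_ne_fun (continuous_mul_const hτ _) continuous_id)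

/-- If `0` is not isolated, each of its neighborhoods meets infinitely many boxes. -/
theorem exists_mk_mem_of_mem_nhds (hτ : ShiftContinuous (BruckZero S))
    (h0 : ¬ IsOpen ({0} : Set (BruckZero S))) {U : Set (BruckZero S)} (hU : U ∈ 𝓝 0) (N : ℕ) :
    ∃ n s m, (N < n ∨ N < m) ∧ mk n s m ∈ U := by
  by_contra! H
  apply h0
  let f := fun x : BruckZero S => mk 0 1 (N + 1) * x * mk (N + 1) 1 0
  let F := (fun p : ℕ × ℕ => mk p.1 (1 : S) p.2) '' (Iic (N + 1, N + 1))
  have hFc : IsClosed F := ((finite_Iic _).image _).isClosed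
  have hFf : f ⁻¹' Fᶜ ∈ 𝓝 0 := (hFc.isOpen_compl.preimage (hτ _ _)).mem_nhds <| by
    rintro ⟨p, -, hp⟩
    simp at hp
  refine isOpen_singleton_iff_nhds_eq_pure _ |>.2 <| le_antisymm ?_ (pure_le_nhds _)
  rw [Filter.le_pure_iff]
  filter_upwards [hU, hFf] with x hxU hxF
  rcases eq_zero_or_eq_mk x with rfl | ⟨n, s, m, rfl⟩
  · rfl
  · refine absurd (shift_lowerBoxes_subset N (mk_mem_lowerBoxes.2 ?_)) hxF
    by_contra h
    exact H n s m (by omega) hxU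

/-- A continuous self-map fixing `0` maps a compact neighborhood `U` of `0` into `U`, up to
finitely many boxes. -/
theorem exists_bound_mapsTo (hτ : ShiftContinuous (BruckZero S)) {U : Set (BruckZero S)}
    (hU : U ∈ 𝓝 0) (hUc : IsCompact U) {f : BruckZero S → BruckZero S} (hf : Continuous f)
    (hf0 : f 0 = 0) :
    ∃ N, ∀ n s m, (N < n ∨ N < m) → mk n s m ∈ U → f (mk n s m) ∈ U := by
  have hV : interior (f ⁻¹' U) ∈ 𝓝 0 :=
    interior_mem_nhds.2 (hf.continuousAt.preimage_mem_nhds (by rwa [hf0]))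
  obtain ⟨N, hN⟩ := (hUc.diff (isOpen_interior (s := f ⁻¹' U))).elim_directed_cover
    (lowerBoxes S) (isOpen_lowerBoxes hτ)
    (fun x hx => mem_iUnion.2 <| exists_mem_lowerBoxes <| by
      rintro rfl
      exact hx.2 (mem_of_mem_nhds hV))
    monotone_lowerBoxes.directed_le
  refine ⟨N, fun n s m hnm hx => ?_⟩
  by_contra hfx
  have := mk_mem_lowerBoxes.1 (hN ⟨hx, fun h => hfx (interior_subset (s := f ⁻¹' U) h)⟩)
  omega

/-- If `0` is not isolated, a compact neighborhood of `0` contains all but finitely many boxes. -/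
theorem exists_bound_mk_mem (hτ : ShiftContinuous (BruckZero S))
    (h0 : ¬ IsOpen ({0} : Set (BruckZero S))) {U : Set (BruckZero S)} (hU : U ∈ 𝓝 0)
    (hUc : IsCompact U) :
    ∃ N, ∀ n s m, (N < n ∨ N < m) → mk n s m ∈ U := by
  have left (a : BruckZero S) :=
    exists_bound_mapsTo hτ hU hUc (continuous_const_mul hτ a) (mul_zero a)
  have right (b : BruckZero S) :=
    exists_bound_mapsTo hτ hU hUc (continuous_mul_const hτ b) (zero_mul b)
  obtain ⟨Nr, hr⟩ := right (mk 0 1 1)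
  obtain ⟨Nl, hl⟩ := right (mk 1 1 0)
  obtain ⟨Nu, hu⟩ := left (mk 1 1 0)
  obtain ⟨Nd, hd⟩ := left (mk 0 1 1)
  obtain ⟨N, hNr, hNl, hNu, hNd⟩ : ∃ N, Nr ≤ N ∧ Nl ≤ N ∧ Nu ≤ N ∧ Nd ≤ N :=
    ⟨Nr + Nl + Nu + Nd, by omega⟩
  have spread (s : S) {n m n' m' : ℕ} (hnm : N < n ∨ N < m)
      (h : mk n s m ∈ U) (hnm' : N < n' ∨ N < m') : mk n' s m' ∈ U := by
    refine Nat.forall_of_unit_steps_of_lt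
      (A := fun n m => mk n s m ∈ U) ?_ ?_ ?_ ?_ hnm h hnm'
    · intro n m hnm hx
      simpa [mul_mk_of_le, add_comm] using hr n s m (by omega) hx
    · intro n m hnm hx
      simpa [mul_mk_of_le] using hl n s (m + 1) (by omega) hx
    · intro n m hnm hx
      simpa [mk_mul_of_le, add_comm] using hu n s m (by omega) hx
    · intro n m hnm hx
      simpa [mk_mul_of_le] using hd (n + 1) s m (by omega) hx
  have one_mem {n m : ℕ} (hnm : N < n ∨ N < m) : mk n 1 m ∈ U := by
    obtain ⟨n₀, s, m₀, h, hx⟩ := exists_mk_mem_of_mem_nhds hτ h0 hU N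
    have h₁ := hl (N + 1) s 0 (by omega) (spread s h hx (by omega))
    rw [mul_of_lt _ _ Nat.zero_lt_one] at h₁
    exact spread 1 (by omega) h₁ hnm
  refine ⟨N, fun n s m hnm => ?_⟩
  obtain ⟨M, hM⟩ := right (mk 0 s 0)
  have h₁ := hM (N + M + 1) 1 0 (by omega) (one_mem (by omega))
  rw [mul_of_eq, one_mul] at h₁
  exact spread s (by omega) h₁ hnm

theorem compactSpace_of_not_isOpen_singleton_zero [LocallyCompactSpace (BruckZero S)]
    (hτ : ShiftContinuous (BruckZero S)) (h0 : ¬ IsOpen ({0} : Set (BruckZero S))) :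
    CompactSpace (BruckZero S) := by
  obtain ⟨U, hUc, hU⟩ := exists_compact_mem_nhds (0 : BruckZero S)
  obtain ⟨N, hN⟩ := exists_bound_mk_mem hτ h0 hU hUc
  refine ⟨(hUc.image (hτ (mk 0 1 (N + 1)) (mk (N + 1) 1 0))).of_isClosed_subset
    isClosed_univ fun x _ => ?_⟩
  rcases eq_zero_or_eq_mk x with rfl | ⟨n, s, m, rfl⟩
  · exact ⟨0, mem_of_mem_nhds hU, by simp⟩
  · refine ⟨mk (n + (N + 1)) s (m + (N + 1)), hN _ _ _ (by omega), ?_⟩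
    simp only
    rw [mk_mul_of_le _ _ _ (by omega), mul_mk_of_le _ _ _ (by omega)]
    simp

end Shifts

end BruckZero

/-- A locally compact Hausdorff shift-continuous topology on `B⁰(B_k)`
in which the adjoined zero `0*` is not isolated is compact. -/
theorem compact_of_zero_not_isolated (k : ℕ)
    [TopologicalSpace (BruckZero (Bicyclic k))] [T2Space (BruckZero (Bicyclic k))]
    [LocallyCompactSpace (BruckZero (Bicyclic k))]
    (hτ : ShiftContinuous (BruckZero (Bicyclic k)))
    (h0 : ¬ IsOpen ({0} : Set (BruckZero (Bicyclic k)))) :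
    CompactSpace (BruckZero (Bicyclic k)) := by
  exact BruckZero.compactSpace_of_not_isOpen_singleton_zero hτ h0
end
end
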